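/- For each i ∈ {1,2,3,4,5} and every subset A of the ground set Eᵢ of Sᵢ, there exist n ≥ 1 and a₁, b₁, …, aₙ, bₙ ∈ Eᵢ with aⱼ ≠ bⱼ for each j such that the iterated handle slide (⋯(((Sᵢ⋆A)_{a₁b₁})_{a₂b₂})⋯)_{aₙbₙ} is not a delta-matroid. Here S₁ = ({1,2,3}, {∅,{1,2},{1,3},{2,3},{1,2,3}}), S₂ = ({1,2,3}, {∅,{1},{2},{3},{1,2},{1,3},{2,3}}), S₃ = ({1,2,3}, {∅,{2},{3},{1,2},{1,3},{1,2,3}}), S₄ = ({1,2,3,4}, {∅,{1,2},{1,3},{1,4},{2,3},{2,4},{3,4}}), and S₅ = ({1,2,3,4}, {∅,{1,2},{1,4},{2,3},{3,4},{1,2,3,4}}). -/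

import Mathlib

/-- A set system: a finite ground set `E` together with a collection `F`
of finite subsets (intended to be subsets of `E`). -/
structure SetSystem (α : Type*) where
  E : Finset α
  F : Set (Finset α)

namespace SetSystem

variable {α : Type*} [DecidableEq α]

/-- A delta-matroid: a set system with nonempty feasible collection, all feasible
sets contained in the ground set, satisfying the symmetric exchange axiom. -/
def IsDeltaMatroid (D : SetSystem α) : Prop :=
  D.F.Nonempty ∧ (∀ F ∈ D.F, F ⊆ D.E) ∧
    ∀ F₁ ∈ D.F, ∀ F₂ ∈ D.F, ∀ x ∈ symmDiff F₁ F₂,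
      ∃ y ∈ symmDiff F₁ F₂, symmDiff F₁ {x, y} ∈ D.F

/-- The handle slide taking `a` over `b`:
`𝓕_{ab} = 𝓕 Δ {X ∪ {a} : X ⊆ E − {a,b}, X ∪ {b} ∈ 𝓕}`. -/
def slide (D : SetSystem α) (a b : α) : SetSystem α :=
  ⟨D.E, symmDiff D.F
    {Y : Finset α | ∃ X : Finset α, X ⊆ D.E \ {a, b} ∧ X ∪ {b} ∈ D.F ∧ Y = X ∪ {a}}⟩

/-- Iterated handle slides along a list of pairs. -/
def slides (D : SetSystem α) : List (α × α) → SetSystem α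
  | [] => D
  | (a, b) :: L => slides (D.slide a b) L

/-- The twist `D ⋆ A = (E, {A Δ X : X ∈ 𝓕})`. -/
def twist (D : SetSystem α) (A : Finset α) : SetSystem α :=
  ⟨D.E, {Y : Finset α | ∃ X ∈ D.F, Y = symmDiff A X}⟩

/-- Deletion of `e`: `D − e = (E − e, {F : F ⊆ E − e, F ∈ 𝓕})`. -/
def del (D : SetSystem α) (e : α) : SetSystem α :=
  ⟨D.E.erase e, {F : Finset α | F ⊆ D.E.erase e ∧ F ∈ D.F}⟩

/-- Contraction of `e`: `D/e = (E − e, {F : F ⊆ E − e, F ∪ {e} ∈ 𝓕})`. -/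
def contr (D : SetSystem α) (e : α) : SetSystem α :=
  ⟨D.E.erase e, {F : Finset α | F ⊆ D.E.erase e ∧ F ∪ {e} ∈ D.F}⟩

/-- The set system `D(A)` of a symmetric binary matrix `A` indexed by `E`:
feasible sets are the `W ⊆ E` whose principal submatrix `A[W]` is invertible
(the empty submatrix being invertible by convention). -/
def ofMatrix (E : Finset α) (A : Matrix E E (ZMod 2)) : SetSystem α :=
  ⟨E, {W : Finset α | ∃ h : ∀ x ∈ W, x ∈ E,
        IsUnit (Matrix.submatrix A
          (fun i : W => (⟨i.1, h i.1 i.2⟩ : E)) (fun i : W => (⟨i.1, h i.1 i.2⟩ : E)))}⟩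

/-- `D` is binary: `D = D(A) ⋆ F` for some feasible `F ∈ 𝓕` and some
symmetric matrix `A` over GF(2) indexed by the ground set. -/
def IsBinary (D : SetSystem α) : Prop :=
  ∃ F ∈ D.F, ∃ A : Matrix D.E D.E (ZMod 2),
    A.IsSymm ∧ D = (ofMatrix D.E A).twist F

/-- `IsMinor D T`: `T` is obtained from `D` by a sequence of deletions and
contractions (keeping feasible collections nonempty). -/
inductive IsMinor : SetSystem α → SetSystem α → Prop
  | refl (D : SetSystem α) : IsMinor D D
  | del {D T : SetSystem α} (e : α) (he : e ∈ D.E) (hne : (D.del e).F.Nonempty)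
      (h : IsMinor (D.del e) T) : IsMinor D T
  | contr {D T : SetSystem α} (e : α) (he : e ∈ D.E) (hne : (D.contr e).F.Nonempty)
      (h : IsMinor (D.contr e) T) : IsMinor D T

/-- Isomorphism of set systems: a bijection of ground sets carrying one
feasible collection onto the other. -/
def Isomorphic {β : Type*} [DecidableEq β] (D : SetSystem α) (D' : SetSystem β) : Prop :=
  ∃ φ : α → β, Set.InjOn φ D.E ∧ D.E.image φ = D'.E ∧
    D'.F = {Y : Finset β | ∃ X ∈ D.F, Y = X.image φ}

end SetSystem

open SetSystem

/-- The minimal non-binary delta-matroids of Bouchet–Duchamp. -/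
def S₁ : SetSystem ℕ := ⟨{1, 2, 3}, {∅, {1, 2}, {1, 3}, {2, 3}, {1, 2, 3}}⟩
def S₂ : SetSystem ℕ := ⟨{1, 2, 3}, {∅, {1}, {2}, {3}, {1, 2}, {1, 3}, {2, 3}}⟩
def S₃ : SetSystem ℕ := ⟨{1, 2, 3}, {∅, {2}, {3}, {1, 2}, {1, 3}, {1, 2, 3}}⟩
def S₄ : SetSystem ℕ := ⟨{1, 2, 3, 4}, {∅, {1, 2}, {1, 3}, {1, 4}, {2, 3}, {2, 4}, {3, 4}}⟩
def S₅ : SetSystem ℕ := ⟨{1, 2, 3, 4}, {∅, {1, 2}, {1, 4}, {2, 3}, {3, 4}, {1, 2, 3, 4}}⟩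

namespace SetSystem

variable {α : Type*} [DecidableEq α]

theorem mem_twist_iff (D : SetSystem α) (A Y : Finset α) :
    Y ∈ (D.twist A).F ↔ symmDiff A Y ∈ D.F := by
  constructor
  · rintro ⟨X, hX, rfl⟩
    rwa [symmDiff_symmDiff_cancel_left]
  · exact fun h => ⟨_, h, (symmDiff_symmDiff_cancel_left A Y).symm⟩

theorem mem_slide_iff (D : SetSystem α) (a b : α) (Y : Finset α) :
    Y ∈ (D.slide a b).F ↔
      Xor (Y ∈ D.F) (a ∈ Y ∧ Y.erase a ⊆ D.E \ {a, b} ∧ Y.erase a ∪ {b} ∈ D.F) := by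
  have key : (∃ X : Finset α, X ⊆ D.E \ {a, b} ∧ X ∪ {b} ∈ D.F ∧ Y = X ∪ {a}) ↔
      (a ∈ Y ∧ Y.erase a ⊆ D.E \ {a, b} ∧ Y.erase a ∪ {b} ∈ D.F) := by
    constructor
    · rintro ⟨X, hX, hF, rfl⟩
      have ha : a ∉ X := fun h => by simpa using hX h
      have hX' : (X ∪ {a}).erase a = X := by
        rw [Finset.union_comm, ← Finset.insert_eq, Finset.erase_insert ha]
      exact ⟨by simp, by rwa [hX'], by rwa [hX']⟩
    · rintro ⟨ha, hE, hF⟩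
      refine ⟨_, hE, hF, ?_⟩
      rw [Finset.union_comm, ← Finset.insert_eq, Finset.insert_erase ha]
  rw [← key]
  rfl

/-- Membership of `Y` in the feasible collection of the handle slide taking `a` over `b` in
the twist by `A` of the set system with ground set `E` and feasible collection `𝓕`. -/
abbrev FeasibleTwistSlide (E : Finset α) (𝓕 : Finset (Finset α)) (A : Finset α) (a b : α)
    (Y : Finset α) : Prop :=
  Xor (symmDiff A Y ∈ 𝓕)
    (a ∈ Y ∧ Y.erase a ⊆ E \ {a, b} ∧ symmDiff A (Y.erase a ∪ {b}) ∈ 𝓕)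

/-- Some handle slide of the twist by `A` violates the symmetric exchange axiom at a pair of
complementary feasible sets. -/
abbrev ViolatesExchange (E : Finset α) (𝓕 : Finset (Finset α)) (A : Finset α) : Prop :=
  ∃ a ∈ E, ∃ b ∈ E, a ≠ b ∧
    ∃ X ∈ E.powerset, FeasibleTwistSlide E 𝓕 A a b X ∧
      FeasibleTwistSlide E 𝓕 A a b (E \ X) ∧
        ∃ x ∈ E, ∀ y ∈ E, ¬ FeasibleTwistSlide E 𝓕 A a b (symmDiff X {x, y})

theorem exists_slides_not_isDeltaMatroid {D : SetSystem α} {𝓕 : Finset (Finset α)}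
    (hF : D.F = 𝓕) {A : Finset α} (h : ViolatesExchange D.E 𝓕 A) :
    ∃ L : List (α × α), L ≠ [] ∧
      (∀ p ∈ L, p.1 ∈ D.E ∧ p.2 ∈ D.E ∧ p.1 ≠ p.2) ∧
      ¬ ((D.twist A).slides L).IsDeltaMatroid := by
  obtain ⟨a, ha, b, hb, hab, X, hX, h₁, h₂, x, hx, hy⟩ := h
  have mem (Y : Finset α) :
      Y ∈ ((D.twist A).slide a b).F ↔ FeasibleTwistSlide D.E 𝓕 A a b Y := by
    rw [mem_slide_iff, mem_twist_iff, mem_twist_iff, hF]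
    rfl
  refine ⟨[(a, b)], by simp, by simp [ha, hb, hab], fun hD => ?_⟩
  have hE : symmDiff X (D.E \ X) = D.E := by
    ext z
    have hz : z ∈ X → z ∈ D.E := fun h => Finset.mem_powerset.1 hX h
    simp only [Finset.mem_symmDiff, Finset.mem_sdiff]
    tauto
  obtain ⟨y, hy', hF'⟩ := hD.2.2 X ((mem X).2 h₁) _ ((mem _).2 h₂) x (hE.symm ▸ hx)
  exact hy y (hE ▸ hy') ((mem _).1 hF')

end SetSystem

/-- for each `Sᵢ` and every subset `A` of its ground set, some
nonempty sequence of handle slides applied to the twist `Sᵢ⋆A` fails to be a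
delta-matroid. -/
theorem stmt_12 :
    ∀ S ∈ [S₁, S₂, S₃, S₄, S₅], ∀ A : Finset ℕ, A ⊆ S.E →
      ∃ L : List (ℕ × ℕ), L ≠ [] ∧
        (∀ p ∈ L, p.1 ∈ S.E ∧ p.2 ∈ S.E ∧ p.1 ≠ p.2) ∧
        ¬ ((S.twist A).slides L).IsDeltaMatroid := by
  have reduce {S : SetSystem ℕ} (𝓕 : Finset (Finset ℕ)) (hF : S.F = 𝓕)
      (h : ∀ A ∈ S.E.powerset, ViolatesExchange S.E 𝓕 A) (A : Finset ℕ) (hA : A ⊆ S.E) :=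
    exists_slides_not_isDeltaMatroid hF (h A (Finset.mem_powerset.2 hA))
  simp only [List.forall_mem_cons, List.not_mem_nil, false_imp_iff, implies_true, and_true]
  refine ⟨reduce {∅, {1, 2}, {1, 3}, {2, 3}, {1, 2, 3}} (by simp [S₁]) ?_,
    reduce {∅, {1}, {2}, {3}, {1, 2}, {1, 3}, {2, 3}} (by simp [S₂]) ?_,
    reduce {∅, {2}, {3}, {1, 2}, {1, 3}, {1, 2, 3}} (by simp [S₃]) ?_,
    reduce {∅, {1, 2}, {1, 3}, {1, 4}, {2, 3}, {2, 4}, {3, 4}} (by simp [S₄]) ?_,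
    reduce {∅, {1, 2}, {1, 4}, {2, 3}, {3, 4}, {1, 2, 3, 4}} (by simp [S₅]) ?_⟩ <;>
  decide +kernel
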